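/- Closure of infinite Gray codes under doubling (Lemma 6.2(3)): if x has an infinite Gray code and |x| ≤ 1/2, then 2*x has an infinite Gray code, i.e. there exists q : ℕ → ℤ that is an infinite Gray code of 2*x. -/

import Mathlib

noncomputable def tent (x : ℝ) : ℝ := 1 - 2 * |x|

def IsGrayCode (p : ℕ → ℤ) (x : ℝ) : Prop :=
  |x| ≤ 1 ∧ (∀ i, p i ∈ ({-1, 1} : Set ℤ)) ∧
    ∀ i, tent^[i] x ≠ 0 →
      (0 < tent^[i] x → p i = 1) ∧ (tent^[i] x < 0 → p i = -1)

theorem tent_neg (x : ℝ) : tent (-x) = tent x := by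
  simp [tent]

theorem tent_two_mul {x : ℝ} (hx : |x| ≤ 1 / 2) : tent (2 * x) = -tent (tent x) := by
  have h : |(1 - 2 * |x|)| = 1 - 2 * |x| := abs_of_nonneg (by linarith)
  simp only [tent, h, abs_mul, abs_two]
  ring

theorem tent_iterate_two_mul {x : ℝ} (hx : |x| ≤ 1 / 2) (n : ℕ) :
    tent^[n + 2] (2 * x) = tent^[n + 3] x := by
  simp only [Function.iterate_succ_apply, tent_two_mul hx, tent_neg]

/-- The code of `2 * x` is `p 0, -p 2, p 3, p 4, …`. -/
def grayDouble (p : ℕ → ℤ) : ℕ → ℤ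
  | 0 => p 0
  | 1 => -p 2
  | n + 2 => p (n + 3)

theorem IsGrayCode.double {p : ℕ → ℤ} {x : ℝ} (h : IsGrayCode p x) (hx : |x| ≤ 1 / 2) :
    IsGrayCode (grayDouble p) (2 * x) := by
  obtain ⟨-, hp, hs⟩ := h
  refine ⟨by rw [abs_mul, abs_two]; linarith, fun i => ?_, fun i hi => ?_⟩
  · match i with
    | 0 => exact hp 0
    | 1 =>
      rcases hp 2 with h2 | h2
      · simp [grayDouble, h2]
      · simp [grayDouble, Set.mem_singleton_iff.mp h2]
    | n + 2 => exact hp (n + 3)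
  · match i with
    | 0 =>
      have hx0 : x ≠ 0 := by simpa using hi
      obtain ⟨hpos, hneg⟩ := hs 0 hx0
      exact ⟨fun h0 => hpos (by simpa using h0),
        fun h0 => hneg (show x < 0 by linarith [show 2 * x < 0 from h0])⟩
    | 1 =>
      have key : tent^[1] (2 * x) = -tent^[2] x := tent_two_mul hx
      rw [key] at hi ⊢
      obtain ⟨hpos, hneg⟩ := hs 2 (neg_ne_zero.mp hi)
      exact ⟨fun h0 => by simp [grayDouble, hneg (neg_pos.mp h0)],
        fun h0 => by simp [grayDouble, hpos (neg_lt_zero.mp h0)]⟩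
    | n + 2 =>
      rw [tent_iterate_two_mul hx] at hi ⊢
      exact hs (n + 3) hi

theorem gray_code_double (x : ℝ) (h : ∃ p : ℕ → ℤ, IsGrayCode p x)
    (hx : |x| ≤ 1 / 2) : ∃ q : ℕ → ℤ, IsGrayCode q (2 * x) := by
  obtain ⟨p, hp⟩ := h
  exact ⟨grayDouble p, hp.double hx⟩
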